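/- In the setting of the single-robot transect value functions, let π̃ be a Markov-optimal policy (each π̃_i attains the maximum in the recursion defining Ṽ_i at every column-i location) and let V^{π̃}_i denote its non-Markovian value on histories. If ξ < ρ/t and ξ⁴ < (ρ/t − ξ)(ρ − ξ²), then for every i with 0 ≤ i ≤ t and every history x_{0:i} of candidate locations with x_j in column j: Ṽ_i(x_i) ≤ V^{π̃}_i(x_{0:i}) + Σ_{s=i}^{t} Δ(s). -/

import Mathlib

open Real

/-- Squared exponential covariance function on ℝ². -/
noncomputable def seCov (σs σn ℓ₁ ℓ₂ : ℝ) (u v : ℝ × ℝ) : ℝ :=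
  σs ^ 2 * Real.exp (-((u.1 - v.1) ^ 2) / (2 * ℓ₁ ^ 2) - (u.2 - v.2) ^ 2 / (2 * ℓ₂ ^ 2)) +
    σn ^ 2 * (if u = v then 1 else 0)

/-- Kernel (covariance) matrix of a finite tuple of locations. -/
noncomputable def kerMat (σs σn ℓ₁ ℓ₂ : ℝ) {ι : Type} [Fintype ι]
    (x : ι → ℝ × ℝ) : Matrix ι ι ℝ :=
  Matrix.of fun j k => seCov σs σn ℓ₁ ℓ₂ (x j) (x k)

/-- Posterior (conditional) variance σ²_{u|x} = σ(u,u) − Σ_{uX} Σ_{XX}⁻¹ Σ_{Xu}. -/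
noncomputable def postVar (σs σn ℓ₁ ℓ₂ : ℝ) (u : ℝ × ℝ) {ι : Type} [Fintype ι] [DecidableEq ι]
    (x : ι → ℝ × ℝ) : ℝ :=
  seCov σs σn ℓ₁ ℓ₂ u u -
    ∑ j, ∑ k, seCov σs σn ℓ₁ ℓ₂ u (x j) * (kerMat σs σn ℓ₁ ℓ₂ x)⁻¹ j k *
      seCov σs σn ℓ₁ ℓ₂ (x k) u

/-- The per-stage bound Δ(i) on the Gaussian conditional mutual information (Δ(0) = 0). -/
noncomputable def Del (ξ ρ : ℝ) (i : ℕ) : ℝ :=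
  if i = 0 then 0
  else (1 / 2) * Real.log (1 - ξ ^ 4 / ((ρ / (i : ℝ) - ξ) * (ρ - ξ ^ 2)))⁻¹

/-- Stagewise Gaussian posterior entropy ½·log(2πe·σ²_{u|x}). -/
noncomputable def ent (σs σn ℓ₁ ℓ₂ : ℝ) (u : ℝ × ℝ) {ι : Type} [Fintype ι] [DecidableEq ι]
    (x : ι → ℝ × ℝ) : ℝ :=
  (1 / 2) * Real.log (2 * Real.pi * Real.exp 1 * postVar σs σn ℓ₁ ℓ₂ u x)

/-- The candidate location in row `m` of column `j` of the transect grid. -/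
noncomputable def loc (ω₁ ω₂ : ℝ) (j m : ℕ) : ℝ × ℝ := ((j : ℝ) * ω₁, (m : ℝ) * ω₂)

/-- The history of sampled locations over columns 0..i induced by the row choices `c`. -/
noncomputable def hist (ω₁ ω₂ : ℝ) {r : ℕ} (c : ℕ → Fin r) (i : ℕ) : Fin (i + 1) → ℝ × ℝ :=
  fun j => loc ω₁ ω₂ (j : ℕ) ((c (j : ℕ) : ℕ) + 1)

/-- A quadratic form with constant diagonal `D` and off-diagonal entries of absolute
value at most `e` dominates `(D - n e)` times the squared norm in dimension `n + 1`. -/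
lemma quadForm_lower_bound {n : ℕ} (M : Matrix (Fin (n + 1)) (Fin (n + 1)) ℝ) (D e : ℝ)
    (he : 0 ≤ e) (hdiag : ∀ j, M j j = D) (hoff : ∀ j k, j ≠ k → |M j k| ≤ e)
    (v : Fin (n + 1) → ℝ) :
    (D - n * e) * ∑ j, v j ^ 2 ≤ ∑ j, ∑ k, v j * M j k * v k := by
  have hentry : ∀ j k, (if j = k then (D + e) * v j ^ 2 else 0) - e * (|v j| * |v k|)
      ≤ v j * M j k * v k := by
    intro j k
    by_cases hjk : j = k
    · subst hjk
      rw [if_pos rfl, hdiag, abs_mul_abs_self]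
      exact le_of_eq (by ring)
    · rw [if_neg hjk]
      have h1 : |v j * M j k * v k| ≤ e * (|v j| * |v k|) := by
        rw [abs_mul, abs_mul]
        calc |v j| * |M j k| * |v k| = |M j k| * (|v j| * |v k|) := by ring
          _ ≤ e * (|v j| * |v k|) := by gcongr; exact hoff j k hjk
      linarith [neg_abs_le (v j * M j k * v k)]
  have hsum := Finset.sum_le_sum fun j (_ : j ∈ Finset.univ) =>
    Finset.sum_le_sum fun k (_ : k ∈ Finset.univ) => hentry j k
  simp only [Finset.sum_sub_distrib, Finset.sum_ite_eq, Finset.mem_univ, if_true,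
    ← Finset.mul_sum, ← Finset.sum_mul] at hsum
  have hcs := sq_sum_le_card_mul_sum_sq (s := (Finset.univ : Finset (Fin (n + 1))))
    (f := fun j => |v j|)
  simp only [sq_abs, Finset.card_univ, Fintype.card_fin] at hcs
  push_cast at hcs
  nlinarith [mul_le_mul_of_nonneg_left hcs he]

/-- Bound on the variance reduction `kᵀ M⁻¹ k` in terms of the reduction due to the last
coordinate alone and the residual correlations `k j - M j last * k last / D`. -/
lemma dotProduct_inv_le {n : ℕ} (M : Matrix (Fin (n + 1)) (Fin (n + 1)) ℝ) (D e β : ℝ)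
    (k : Fin (n + 1) → ℝ) (he : 0 ≤ e) (hD : n * e < D) (hsymm : ∀ i j, M i j = M j i)
    (hdiag : ∀ j, M j j = D) (hoff : ∀ i j, i ≠ j → |M i j| ≤ e) (hdet : IsUnit M.det)
    (hb : ∀ j : Fin n, |k j.castSucc - M j.castSucc (Fin.last n) * k (Fin.last n) / D| ≤ β) :
    k ⬝ᵥ (M⁻¹.mulVec k) ≤ k (Fin.last n) ^ 2 / D + n * β ^ 2 / (D - n * e) := by
  have hD0 : 0 < D := lt_of_le_of_lt (by positivity) hD
  have hlam : 0 < D - n * e := by linarith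
  set L := Fin.last n
  set w := M⁻¹.mulVec k with hw
  have hMw : M.mulVec w = k := by
    rw [hw, Matrix.mulVec_mulVec, Matrix.mul_nonsing_inv _ hdet, Matrix.one_mulVec]
  set γ := k L / D with hγ
  set v : Fin (n + 1) → ℝ := w - γ • Pi.single L 1 with hv
  set b : Fin (n + 1) → ℝ := M.mulVec v with hbdef
  have hbj : ∀ j, b j = k j - M j L * k L / D := by
    intro j
    rw [hbdef, hv, Matrix.mulVec_sub, hMw, Matrix.mulVec_smul]
    simp [hγ]
    ring
  have hbL : b L = 0 := by
    rw [hbj, hdiag]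
    field_simp
    ring
  have hbv : b ⬝ᵥ v = ∑ i, ∑ j, v i * M i j * v j := by
    rw [dotProduct_comm, hbdef]
    simp only [dotProduct, Matrix.mulVec, Finset.mul_sum]
    exact Finset.sum_congr rfl fun i _ => Finset.sum_congr rfl fun j _ => by ring
  have hlow := quadForm_lower_bound M D e he hdiag hoff v
  rw [← hbv] at hlow
  have hkw : k ⬝ᵥ w = b ⬝ᵥ v + k L ^ 2 / D := by
    have hk : k = b + γ • fun j => M j L := by
      funext j
      simp [hbj, hγ]
      ring
    have hw' : w = v + γ • Pi.single L 1 := by simp [hv]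
    have hMv : (fun j => M j L) ⬝ᵥ v = b L := by
      simp only [hbdef, dotProduct, Matrix.mulVec, hsymm L]
    conv_lhs => rw [hk, hw']
    rw [add_dotProduct, dotProduct_add, dotProduct_add, smul_dotProduct, smul_dotProduct,
      hMv, hbL]
    simp [hbL, hdiag, hγ]
    field_simp
  have hbsq : ∑ j, b j ^ 2 ≤ n * β ^ 2 := by
    rw [Fin.sum_univ_castSucc]
    have h1 : ∀ j : Fin n, b j.castSucc ^ 2 ≤ β ^ 2 := by
      intro j
      rw [hbj]
      exact sq_le_sq' (abs_le.mp (hb j)).1 (abs_le.mp (hb j)).2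
    have h2 := Finset.sum_le_sum fun j (_ : j ∈ Finset.univ) => h1 j
    simp only [Finset.sum_const, Finset.card_univ, Fintype.card_fin, nsmul_eq_mul] at h2
    have h3 : b (Fin.last n) = 0 := hbL
    rw [h3]
    linarith
  have hyoung : 2 * (D - n * e) * (b ⬝ᵥ v) ≤
      ∑ j, b j ^ 2 + (D - n * e) ^ 2 * ∑ j, v j ^ 2 := by
    simp only [dotProduct, Finset.mul_sum]
    rw [← Finset.sum_add_distrib]
    exact Finset.sum_le_sum fun j _ => by nlinarith [sq_nonneg (b j - (D - n * e) * v j)]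
  have hfin : b ⬝ᵥ v ≤ n * β ^ 2 / (D - n * e) := by
    rw [le_div_iff₀ hlam]
    nlinarith [mul_le_mul_of_nonneg_left hlow hlam.le]
  linarith

lemma loc_injective_column {ω₁ ω₂ : ℝ} (hω₁ : 0 < ω₁) {a b p q : ℕ}
    (h : loc ω₁ ω₂ a p = loc ω₁ ω₂ b q) : a = b := by
  have h1 := congrArg Prod.fst h
  simp only [loc] at h1
  exact_mod_cast mul_right_cancel₀ hω₁.ne' h1

lemma seCov_comm (σs σn ℓ₁ ℓ₂ : ℝ) (u v : ℝ × ℝ) :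
    seCov σs σn ℓ₁ ℓ₂ u v = seCov σs σn ℓ₁ ℓ₂ v u := by
  simp only [seCov, eq_comm (a := u) (b := v), sub_sq_comm u.1 v.1, sub_sq_comm u.2 v.2]

lemma seCov_self (σs σn ℓ₁ ℓ₂ : ℝ) (u : ℝ × ℝ) :
    seCov σs σn ℓ₁ ℓ₂ u u = σs ^ 2 + σn ^ 2 := by
  simp [seCov]

lemma seCov_nonneg (σs σn ℓ₁ ℓ₂ : ℝ) (u v : ℝ × ℝ) : 0 ≤ seCov σs σn ℓ₁ ℓ₂ u v := by
  unfold seCov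
  positivity

/-- Covariance of locations in distinct columns decays with the squared column distance. -/
lemma seCov_loc_le (σs σn ℓ₁ ℓ₂ : ℝ) {ω₁ ω₂ : ℝ} (hω₁ : 0 < ω₁) {a b p q d : ℕ}
    (hab : a ≠ b) (hd : (d : ℝ) ≤ ((a : ℝ) - b) ^ 2) :
    seCov σs σn ℓ₁ ℓ₂ (loc ω₁ ω₂ a p) (loc ω₁ ω₂ b q) ≤
      σs ^ 2 * Real.exp (-ω₁ ^ 2 / (2 * ℓ₁ ^ 2)) ^ d := by
  have hne : loc ω₁ ω₂ a p ≠ loc ω₁ ω₂ b q := fun h => hab (loc_injective_column hω₁ h)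
  rw [seCov, if_neg hne, mul_zero, add_zero, ← Real.exp_nat_mul]
  gcongr
  have h2 : 0 ≤ ((loc ω₁ ω₂ a p).2 - (loc ω₁ ω₂ b q).2) ^ 2 / (2 * ℓ₂ ^ 2) := by positivity
  have h1 : -((loc ω₁ ω₂ a p).1 - (loc ω₁ ω₂ b q).1) ^ 2 / (2 * ℓ₁ ^ 2) =
      -(((a : ℝ) - b) ^ 2 * (ω₁ ^ 2 / (2 * ℓ₁ ^ 2))) := by
    simp only [loc]
    ring
  have h3 : (d : ℝ) * (ω₁ ^ 2 / (2 * ℓ₁ ^ 2)) ≤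
      ((a : ℝ) - b) ^ 2 * (ω₁ ^ 2 / (2 * ℓ₁ ^ 2)) := by gcongr
  rw [h1]
  have h4 : (d : ℝ) * (-ω₁ ^ 2 / (2 * ℓ₁ ^ 2)) = -(d * (ω₁ ^ 2 / (2 * ℓ₁ ^ 2))) := by ring
  linarith

lemma postVar_eq_dotProduct (σs σn ℓ₁ ℓ₂ : ℝ) (u : ℝ × ℝ) {ι : Type} [Fintype ι]
    [DecidableEq ι] (x : ι → ℝ × ℝ) :
    postVar σs σn ℓ₁ ℓ₂ u x = σs ^ 2 + σn ^ 2 -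
      (fun j => seCov σs σn ℓ₁ ℓ₂ (x j) u) ⬝ᵥ
        ((kerMat σs σn ℓ₁ ℓ₂ x)⁻¹.mulVec fun j => seCov σs σn ℓ₁ ℓ₂ (x j) u) := by
  simp only [postVar, seCov_self, dotProduct, Matrix.mulVec, Finset.mul_sum,
    seCov_comm σs σn ℓ₁ ℓ₂ u, mul_assoc]

lemma postVar_single (σs σn ℓ₁ ℓ₂ : ℝ) (u y : ℝ × ℝ) :
    postVar σs σn ℓ₁ ℓ₂ u (fun _ : Fin 1 => y) =
      σs ^ 2 + σn ^ 2 - seCov σs σn ℓ₁ ℓ₂ y u ^ 2 / (σs ^ 2 + σn ^ 2) := by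
  rw [postVar_eq_dotProduct, Matrix.inv_subsingleton]
  simp [Matrix.mulVec, dotProduct, kerMat, seCov_self]
  ring

/-- Conditioning on the whole history rather than on its last location lowers the variance of a
location in the next column by at most `σs² n ξ⁴ / (ρ - n ξ)`, written without normalisation. -/
lemma postVar_hist_ge (σs σn ℓ₁ ℓ₂ ω₁ ω₂ ξ : ℝ) (hσs : 0 < σs) (hω₁ : 0 < ω₁)
    (hξ : ξ = Real.exp (-ω₁ ^ 2 / (2 * ℓ₁ ^ 2))) {r : ℕ} (c : ℕ → Fin r) (n a : ℕ)
    (hdet : IsUnit (kerMat σs σn ℓ₁ ℓ₂ (hist ω₁ ω₂ c n)).det)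
    (hn : n * (σs ^ 2 * ξ) < σs ^ 2 + σn ^ 2) :
    postVar σs σn ℓ₁ ℓ₂ (loc ω₁ ω₂ (n + 1) a)
        (fun _ : Fin 1 => loc ω₁ ω₂ n ((c n : ℕ) + 1)) -
        n * (σs ^ 2 * ξ ^ 2) ^ 2 / (σs ^ 2 + σn ^ 2 - n * (σs ^ 2 * ξ)) ≤
      postVar σs σn ℓ₁ ℓ₂ (loc ω₁ ω₂ (n + 1) a) (hist ω₁ ω₂ c n) := by
  have hξ0 : 0 < ξ := hξ ▸ Real.exp_pos _
  have hD : 0 < σs ^ 2 + σn ^ 2 := by positivity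
  have hfar : ∀ {i j p q : ℕ}, i ≠ j →
      seCov σs σn ℓ₁ ℓ₂ (loc ω₁ ω₂ i p) (loc ω₁ ω₂ j q) ≤ σs ^ 2 * ξ := by
    intro i j p q hij
    have hd : ((1 : ℕ) : ℝ) ≤ ((i : ℝ) - j) ^ 2 := by
      have : (1 : ℤ) ≤ ((i : ℤ) - j) ^ 2 := by
        have : (i : ℤ) - j ≠ 0 := sub_ne_zero.mpr (by exact_mod_cast hij)
        have := pow_pos (abs_pos.mpr this) 2
        rw [sq_abs] at this
        omega
      exact_mod_cast this
    have h := seCov_loc_le σs σn ℓ₁ ℓ₂ (ω₂ := ω₂) hω₁ (p := p) (q := q) hij hd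
    rwa [pow_one, ← hξ] at h
  have key := dotProduct_inv_le (kerMat σs σn ℓ₁ ℓ₂ (hist ω₁ ω₂ c n)) (σs ^ 2 + σn ^ 2)
    (σs ^ 2 * ξ) (σs ^ 2 * ξ ^ 2)
    (fun j => seCov σs σn ℓ₁ ℓ₂ (hist ω₁ ω₂ c n j) (loc ω₁ ω₂ (n + 1) a))
    (by positivity) hn (fun i j => seCov_comm _ _ _ _ _ _) (fun j => seCov_self _ _ _ _ _)
    (fun i j hij => by
      simp only [kerMat, Matrix.of_apply]
      rw [abs_of_nonneg (seCov_nonneg _ _ _ _ _ _)]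
      exact hfar fun h => hij (Fin.ext h))
    hdet
    (fun j => by
      simp only [kerMat, Matrix.of_apply, hist, Fin.val_castSucc, Fin.val_last]
      have hj := j.isLt
      have hA0 := seCov_nonneg σs σn ℓ₁ ℓ₂ (loc ω₁ ω₂ j ((c j : ℕ) + 1)) (loc ω₁ ω₂ (n + 1) a)
      have hB0 := seCov_nonneg σs σn ℓ₁ ℓ₂ (loc ω₁ ω₂ j ((c j : ℕ) + 1))
        (loc ω₁ ω₂ n ((c n : ℕ) + 1))
      have hC0 := seCov_nonneg σs σn ℓ₁ ℓ₂ (loc ω₁ ω₂ n ((c n : ℕ) + 1)) (loc ω₁ ω₂ (n + 1) a)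
      have hB := hfar (p := (c j : ℕ) + 1) (q := (c n : ℕ) + 1) hj.ne
      have hC := hfar (p := (c n : ℕ) + 1) (q := a) (Nat.succ_ne_self n).symm
      have hd : ((2 : ℕ) : ℝ) ≤ (((j : ℕ) : ℝ) - ((n + 1 : ℕ) : ℝ)) ^ 2 := by
        have : ((j : ℕ) : ℝ) + 1 ≤ n := by exact_mod_cast hj
        push_cast
        nlinarith
      have hA := seCov_loc_le σs σn ℓ₁ ℓ₂ (ω₂ := ω₂) hω₁ (p := (c j : ℕ) + 1) (q := a)
        (show (j : ℕ) ≠ n + 1 by omega) hd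
      rw [← hξ] at hA
      have hBC : seCov σs σn ℓ₁ ℓ₂ (loc ω₁ ω₂ j ((c j : ℕ) + 1)) (loc ω₁ ω₂ n ((c n : ℕ) + 1)) *
          seCov σs σn ℓ₁ ℓ₂ (loc ω₁ ω₂ n ((c n : ℕ) + 1)) (loc ω₁ ω₂ (n + 1) a) /
          (σs ^ 2 + σn ^ 2) ≤ σs ^ 2 * ξ ^ 2 := by
        rw [div_le_iff₀ hD]
        calc _ ≤ (σs ^ 2 * ξ) * (σs ^ 2 * ξ) := mul_le_mul hB hC hC0 (by positivity)
          _ = σs ^ 2 * ξ ^ 2 * σs ^ 2 := by ring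
          _ ≤ _ := by gcongr; nlinarith [sq_nonneg σn]
      have hBC0 := div_nonneg (mul_nonneg hB0 hC0) hD.le
      rw [abs_le]
      constructor <;> linarith)
  simp only [hist, Fin.val_last] at key
  rw [postVar_single, postVar_eq_dotProduct]
  simp only [hist]
  linarith

/-- Stagewise loss of the Markov approximation of the posterior entropy. -/
lemma ent_single_le_ent_hist_add_Del (σs σn ℓ₁ ℓ₂ ω₁ ω₂ ξ ρ : ℝ)
    (hσs : 0 < σs) (hω₁ : 0 < ω₁)
    (hξ : ξ = Real.exp (-ω₁ ^ 2 / (2 * ℓ₁ ^ 2))) (hξ1 : ξ < 1)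
    (hρ : ρ = 1 + σn ^ 2 / σs ^ 2) {r : ℕ} (c : ℕ → Fin r) (n a : ℕ)
    (hdet : IsUnit (kerMat σs σn ℓ₁ ℓ₂ (hist ω₁ ω₂ c n)).det)
    (hξρ : n ≠ 0 → ξ < ρ / n) (hξ4 : n ≠ 0 → ξ ^ 4 < (ρ / n - ξ) * (ρ - ξ ^ 2)) :
    ent σs σn ℓ₁ ℓ₂ (loc ω₁ ω₂ (n + 1) a) (fun _ : Fin 1 => loc ω₁ ω₂ n ((c n : ℕ) + 1)) ≤
      ent σs σn ℓ₁ ℓ₂ (loc ω₁ ω₂ (n + 1) a) (hist ω₁ ω₂ c n) + Del ξ ρ n := by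
  rcases Nat.eq_zero_or_pos n with rfl | hnpos
  · have : hist ω₁ ω₂ c 0 = fun _ : Fin 1 => loc ω₁ ω₂ 0 ((c 0 : ℕ) + 1) := by
      funext j
      rw [Fin.fin_one_eq_zero j]
      rfl
    rw [this]
    simp [Del]
  have hn0 : n ≠ 0 := hnpos.ne'
  have hnR : (0 : ℝ) < n := by exact_mod_cast hnpos
  have hξ0 : 0 < ξ := hξ ▸ Real.exp_pos _
  have hσ2 : 0 < σs ^ 2 := by positivity
  have hD : σs ^ 2 + σn ^ 2 = σs ^ 2 * ρ := by rw [hρ]; field_simp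
  have hρ1 : 1 ≤ ρ := by
    have : 0 ≤ σn ^ 2 / σs ^ 2 := by positivity
    linarith
  have hgap : 0 < ρ / n - ξ := sub_pos.mpr (hξρ hn0)
  have hρξ : 0 < ρ - ξ ^ 2 := by nlinarith
  set q := ξ ^ 4 / ((ρ / n - ξ) * (ρ - ξ ^ 2)) with hq
  have hq1 : 0 < 1 - q := sub_pos.mpr ((div_lt_one (mul_pos hgap hρξ)).mpr (hξ4 hn0))
  have hnξ : n * ξ < ρ := by
    have := (lt_div_iff₀ hnR).mp (hξρ hn0)
    linarith
  have hge := postVar_hist_ge σs σn ℓ₁ ℓ₂ ω₁ ω₂ ξ hσs hω₁ hξ c n a hdet (by rw [hD]; nlinarith)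
  set P := postVar σs σn ℓ₁ ℓ₂ (loc ω₁ ω₂ (n + 1) a)
    (fun _ : Fin 1 => loc ω₁ ω₂ n ((c n : ℕ) + 1)) with hP
  have hPge : σs ^ 2 * (ρ - ξ ^ 2) ≤ P := by
    rw [hP, postVar_single, hD]
    have hC0 := seCov_nonneg σs σn ℓ₁ ℓ₂ (loc ω₁ ω₂ n ((c n : ℕ) + 1)) (loc ω₁ ω₂ (n + 1) a)
    have hC := seCov_loc_le σs σn ℓ₁ ℓ₂ (ω₂ := ω₂) hω₁ (p := (c n : ℕ) + 1) (q := a) (d := 1)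
      (Nat.succ_ne_self n).symm (by push_cast; ring_nf; exact le_rfl)
    rw [← hξ, pow_one] at hC
    have : seCov σs σn ℓ₁ ℓ₂ (loc ω₁ ω₂ n ((c n : ℕ) + 1)) (loc ω₁ ω₂ (n + 1) a) ^ 2 /
        (σs ^ 2 * ρ) ≤ σs ^ 2 * ξ ^ 2 := by
      rw [div_le_iff₀ (by positivity)]
      calc _ ≤ (σs ^ 2 * ξ) ^ 2 := by gcongr
        _ = σs ^ 2 * ξ ^ 2 * (σs ^ 2 * 1) := by ring
        _ ≤ _ := by gcongr
    linarith
  have hP0 : 0 < P := lt_of_lt_of_le (by positivity) hPge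
  have hloss : n * (σs ^ 2 * ξ ^ 2) ^ 2 / (σs ^ 2 + σn ^ 2 - n * (σs ^ 2 * ξ)) =
      q * (σs ^ 2 * (ρ - ξ ^ 2)) := by
    have h1 : ρ - n * ξ ≠ 0 := by linarith
    have h2 : ρ / n - ξ = (ρ - n * ξ) / n := by field_simp
    rw [hq, hD, h2, show σs ^ 2 * ρ - n * (σs ^ 2 * ξ) = σs ^ 2 * (ρ - n * ξ) by ring]
    field_simp
  have hq0 : 0 ≤ q := by positivity
  have hmain : (1 - q) * P ≤
      postVar σs σn ℓ₁ ℓ₂ (loc ω₁ ω₂ (n + 1) a) (hist ω₁ ω₂ c n) := by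
    rw [hloss] at hge
    nlinarith [mul_le_mul_of_nonneg_left hPge hq0]
  have hlog := Real.log_le_log (by positivity : 0 < 2 * Real.pi * Real.exp 1 * ((1 - q) * P))
    (mul_le_mul_of_nonneg_left hmain (by positivity))
  rw [show 2 * Real.pi * Real.exp 1 * ((1 - q) * P) =
    (1 - q) * (2 * Real.pi * Real.exp 1 * P) by ring,
    Real.log_mul hq1.ne' (by positivity)] at hlog
  rw [ent, ent, Del, if_neg hn0, ← hq, Real.log_inv, ← hP]
  linarith

theorem stmt_9 (σs σn ℓ₁ ℓ₂ ω₁ ω₂ ξ ρ : ℝ)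
    (hσs : 0 < σs) (hσn : 0 < σn) (hℓ₁ : 0 < ℓ₁) (hℓ₂ : 0 < ℓ₂)
    (hω₁ : 0 < ω₁) (hω₂ : 0 < ω₂)
    (hξ : ξ = Real.exp (-ω₁ ^ 2 / (2 * ℓ₁ ^ 2)))
    (hρ : ρ = 1 + σn ^ 2 / σs ^ 2)
    (t r : ℕ) (ht : 1 ≤ t) (hr : 1 ≤ r)
    (hPD : ∀ (n : ℕ) (z : Fin n → ℝ × ℝ),
      (∀ p, ∃ a b : ℕ, z p = loc ω₁ ω₂ a b) → Function.Injective z →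
        (kerMat σs σn ℓ₁ ℓ₂ z).PosDef)
    (hξρ : ξ < ρ / t) (hξ4 : ξ ^ 4 < (ρ / t - ξ) * (ρ - ξ ^ 2))
    -- Markov value functions Ṽ_i on column-i candidate locations
    (Vtil : ℕ → ℝ × ℝ → ℝ)
    (hVtilT : ∀ m : Fin r,
      Vtil t (loc ω₁ ω₂ t ((m : ℕ) + 1)) = ⨆ a : Fin r,
        ent σs σn ℓ₁ ℓ₂ (loc ω₁ ω₂ (t + 1) ((a : ℕ) + 1))
          (fun _ : Fin 1 => loc ω₁ ω₂ t ((m : ℕ) + 1)))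
    (hVtilI : ∀ i < t, ∀ m : Fin r,
      Vtil i (loc ω₁ ω₂ i ((m : ℕ) + 1)) = ⨆ a : Fin r,
        (ent σs σn ℓ₁ ℓ₂ (loc ω₁ ω₂ (i + 1) ((a : ℕ) + 1))
            (fun _ : Fin 1 => loc ω₁ ω₂ i ((m : ℕ) + 1)) +
          Vtil (i + 1) (loc ω₁ ω₂ (i + 1) ((a : ℕ) + 1))))
    -- a Markov-optimal policy π̃: it attains the maximum in the recursion defining Ṽ
    (pol : ℕ → ℝ × ℝ → Fin r)
    (hpolT : ∀ m : Fin r,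
      ent σs σn ℓ₁ ℓ₂ (loc ω₁ ω₂ (t + 1) ((pol t (loc ω₁ ω₂ t ((m : ℕ) + 1)) : ℕ) + 1))
          (fun _ : Fin 1 => loc ω₁ ω₂ t ((m : ℕ) + 1)) =
        Vtil t (loc ω₁ ω₂ t ((m : ℕ) + 1)))
    (hpolI : ∀ i < t, ∀ m : Fin r,
      ent σs σn ℓ₁ ℓ₂ (loc ω₁ ω₂ (i + 1) ((pol i (loc ω₁ ω₂ i ((m : ℕ) + 1)) : ℕ) + 1))
          (fun _ : Fin 1 => loc ω₁ ω₂ i ((m : ℕ) + 1)) +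
        Vtil (i + 1) (loc ω₁ ω₂ (i + 1) ((pol i (loc ω₁ ω₂ i ((m : ℕ) + 1)) : ℕ) + 1)) =
        Vtil i (loc ω₁ ω₂ i ((m : ℕ) + 1)))
    -- the non-Markovian value V^{π̃}_i of following π̃
    (Vpi : ℕ → (ℕ → Fin r) → ℝ)
    (hVpiT : ∀ c : ℕ → Fin r,
      Vpi t c = ent σs σn ℓ₁ ℓ₂
        (loc ω₁ ω₂ (t + 1) ((pol t (loc ω₁ ω₂ t ((c t : ℕ) + 1)) : ℕ) + 1)) (hist ω₁ ω₂ c t))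
    (hVpiI : ∀ i < t, ∀ c : ℕ → Fin r,
      Vpi i c = ent σs σn ℓ₁ ℓ₂
          (loc ω₁ ω₂ (i + 1) ((pol i (loc ω₁ ω₂ i ((c i : ℕ) + 1)) : ℕ) + 1)) (hist ω₁ ω₂ c i) +
        Vpi (i + 1) (Function.update c (i + 1) (pol i (loc ω₁ ω₂ i ((c i : ℕ) + 1))))) :
    ∀ i ≤ t, ∀ c : ℕ → Fin r,
      Vtil i (loc ω₁ ω₂ i ((c i : ℕ) + 1)) ≤ Vpi i c + ∑ s ∈ Finset.Icc i t, Del ξ ρ s := by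
  have hξ0 : 0 < ξ := hξ ▸ Real.exp_pos _
  have hξ1 : ξ < 1 := by
    rw [hξ, Real.exp_lt_one_iff, neg_div]
    exact neg_neg_of_pos (by positivity)
  have hρ1 : 1 ≤ ρ := by
    have : 0 ≤ σn ^ 2 / σs ^ 2 := by positivity
    linarith
  have hρξ : 0 < ρ - ξ ^ 2 := by nlinarith
  have hmono : ∀ n ≤ t, n ≠ 0 → ρ / t ≤ ρ / n := by
    intro n hn hn0
    have : (0 : ℝ) < n := by exact_mod_cast Nat.pos_of_ne_zero hn0
    gcongr
  have hstage : ∀ n ≤ t, ∀ (c : ℕ → Fin r) (a : ℕ),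
      ent σs σn ℓ₁ ℓ₂ (loc ω₁ ω₂ (n + 1) a) (fun _ : Fin 1 => loc ω₁ ω₂ n ((c n : ℕ) + 1)) ≤
        ent σs σn ℓ₁ ℓ₂ (loc ω₁ ω₂ (n + 1) a) (hist ω₁ ω₂ c n) + Del ξ ρ n := by
    intro n hn c a
    refine ent_single_le_ent_hist_add_Del σs σn ℓ₁ ℓ₂ ω₁ ω₂ ξ ρ hσs hω₁ hξ hξ1 hρ c n a ?_
      (fun hn0 => hξρ.trans_le (hmono n hn hn0)) (fun hn0 => hξ4.trans_le ?_)
    · exact (hPD _ (hist ω₁ ω₂ c n) (fun p => ⟨_, _, rfl⟩)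
        fun i j h => Fin.ext (loc_injective_column hω₁ h)).det_pos.ne'.isUnit
    · exact mul_le_mul_of_nonneg_right (sub_le_sub_right (hmono n hn hn0) ξ) hρξ.le
  intro i hi
  induction hi using Nat.decreasingInduction with
  | self =>
    intro c
    rw [← hpolT, hVpiT, Finset.Icc_self, Finset.sum_singleton]
    exact hstage t le_rfl c _
  | of_succ i hi ih =>
    intro c
    have h1 := hstage i hi.le c ((pol i (loc ω₁ ω₂ i ((c i : ℕ) + 1)) : ℕ) + 1)
    have h2 := ih (Function.update c (i + 1) (pol i (loc ω₁ ω₂ i ((c i : ℕ) + 1))))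
    rw [Function.update_self] at h2
    rw [← hpolI i hi, hVpiI i hi, ← Finset.sum_Ioc_add_eq_sum_Icc hi.le]
    have h3 : Finset.Ioc i t = Finset.Icc (i + 1) t := by ext s; simp
    rw [h3]
    linarith
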